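/- Let Ω ⊂ ℝⁿ be bounded open with smooth boundary, W ≥ 0 continuous, and u^ε a smooth solution of ε ∂ₜu = εΔu − W'(u)/ε on Ω × (0,∞) with Neumann boundary condition and with energy E^ε[u^ε(·,t)] = ∫_Ω (ε|∇u^ε|²/2 + W(u^ε)/ε) dx ≤ c₁ for all t. Then for every nonnegative φ ∈ C²(closure of Ω), the function t ↦ ∫_Ω φ dμ_t^ε − c₁ ‖φ‖_{C²} t is monotone nonincreasing on [0,∞), where dμ_t^ε = (ε|∇u^ε(·,t)|²/2 + W(u^ε(·,t))/ε) dx. -/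

import Mathlib

open scoped RealInnerProductSpace BigOperators
open MeasureTheory

/-- squared gradient bound -/
lemma grad_sq_le {E : Type*} [NormedAddCommGroup E] [InnerProductSpace ℝ E] [CompleteSpace E]
    (φ : E → ℝ) (hφ : ContDiff ℝ 2 φ) (hφ0 : ∀ x, 0 ≤ φ x) (M : ℝ)
    (hM : ∀ x, |φ x| ≤ M ∧ ‖gradient φ x‖ ≤ M ∧ ‖iteratedFDeriv ℝ 2 φ x‖ ≤ M) (x : E) :
    ‖gradient φ x‖ ^ 2 ≤ 2 * M * φ x := by
  have hM0 : 0 ≤ M := (abs_nonneg _).trans (hM x).1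
  rcases hM0.eq_or_lt with h0 | hMp
  · have := (hM x).2.1
    rw [← h0] at this ⊢
    have h2 : ‖gradient φ x‖ = 0 := le_antisymm this (norm_nonneg _)
    simp [h2]
  have hd : Differentiable ℝ φ := hφ.differentiable (by norm_num)
  have hd2 : Differentiable ℝ (fderiv ℝ φ) :=
    (hφ.fderiv_right (m := 1) (by norm_num)).differentiable (by norm_num)
  have hnorm : ∀ y, ‖fderiv ℝ (fderiv ℝ φ) y‖ ≤ M := by
    intro y
    have h1 := (hM y).2.2
    rw [← norm_iteratedFDeriv_fderiv (n := 1), norm_iteratedFDeriv_one] at h1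
    exact h1
  have hlip : ∀ y z, ‖fderiv ℝ φ z - fderiv ℝ φ y‖ ≤ M * ‖z - y‖ := fun y z =>
    Convex.norm_image_sub_le_of_norm_fderiv_le (fun y _ => hd2 y) (fun y _ => hnorm y)
      convex_univ (Set.mem_univ y) (Set.mem_univ z)
  set w := gradient φ x with hw
  have hww : fderiv ℝ φ x w = ‖w‖ ^ 2 := by
    rw [← inner_gradient_left, ← hw, real_inner_self_eq_norm_sq]
  have hderiv : ∀ s : ℝ, HasDerivAt (fun s : ℝ => φ (x - s • w) + s * ‖w‖ ^ 2 - M * ‖w‖ ^ 2 * (s ^ 2 / 2))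
      (fderiv ℝ φ (x - s • w) (-w) + ‖w‖ ^ 2 - M * ‖w‖ ^ 2 * s) s := by
    intro s
    have h1 : HasDerivAt (fun s : ℝ => x - s • w) (-w) s := by
      simpa using ((hasDerivAt_id s).smul_const w).const_sub x
    have h2 := (hd (x - s • w)).hasFDerivAt.comp_hasDerivAt s h1
    have h3 := (hasDerivAt_id s).mul_const (‖w‖ ^ 2)
    have h4 := (((hasDerivAt_id s).pow 2).div_const 2).const_mul (M * ‖w‖ ^ 2)
    have := (h2.add h3).sub h4
    refine this.congr_deriv ?_
    simp
  have hanti : AntitoneOn (fun s : ℝ => φ (x - s • w) + s * ‖w‖ ^ 2 - M * ‖w‖ ^ 2 * (s ^ 2 / 2))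
      (Set.Ici 0) := by
    apply antitoneOn_of_deriv_nonpos (convex_Ici 0)
    · exact fun s _ => (hderiv s).continuousAt.continuousWithinAt
    · exact fun s _ => (hderiv s).differentiableAt.differentiableWithinAt
    · intro s hs
      rw [interior_Ici] at hs
      rw [(hderiv s).deriv]
      have hs' : 0 < s := hs
      have h1 := hlip x (x - s • w)
      have h2 : (fderiv ℝ φ (x - s • w) - fderiv ℝ φ x) (-w) ≤ M * ‖x - s • w - x‖ * ‖w‖ := by
        refine (le_abs_self _).trans ?_
        rw [← Real.norm_eq_abs]
        refine (ContinuousLinearMap.le_opNorm _ (-w)).trans ?_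
        rw [norm_neg]
        gcongr
      have h3 : ‖x - s • w - x‖ = s * ‖w‖ := by
        rw [show x - s • w - x = -(s • w) by abel, norm_neg, norm_smul, Real.norm_eq_abs, abs_of_pos hs']
      rw [h3, sub_apply, map_neg, map_neg, hww] at h2
      rw [map_neg]
      nlinarith
  have := hanti (Set.mem_Ici.2 le_rfl) (Set.mem_Ici.2 (inv_nonneg.2 hM0)) (inv_nonneg.2 hM0)
  simp at this
  have h5 := hφ0 (x - M⁻¹ • w)
  have h6 : M⁻¹ * ‖w‖ ^ 2 - M * ‖w‖ ^ 2 * ((M ^ 2)⁻¹ / 2) ≤ φ x := by linarith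
  have h7 : M⁻¹ * ‖w‖ ^ 2 - M * ‖w‖ ^ 2 * ((M ^ 2)⁻¹ / 2) = ‖w‖ ^ 2 / (2 * M) := by
    field_simp; ring
  rw [h7, div_le_iff₀ (by positivity)] at h6
  linarith

/-- pointwise inequality -/
lemma pointwise_ineq (ε v a p M g : ℝ) (hε : 0 < ε) (hp : 0 ≤ p) 
    (ha : a ^ 2 ≤ 2 * M * p * g) (hM : 0 ≤ M) (hg : 0 ≤ g) :
    - ε * v * a - ε * p * v ^ 2 ≤ M * (ε * g / 2) := by
  suffices h : - v * a - p * v ^ 2 ≤ M * g / 2 by nlinarith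
  rcases hp.eq_or_lt with h0 | hp
  · subst h0
    have : a = 0 := by nlinarith [sq_nonneg a, pow_eq_zero_iff (a := a) two_ne_zero]
    subst this
    simp; positivity
  · have h1 : 0 ≤ (2 * p * v + a) ^ 2 := sq_nonneg _
    have h2 : (- v * a - p * v ^ 2) * (4 * p) ≤ M * g / 2 * (4 * p) := by nlinarith
    exact le_of_mul_le_mul_right h2 (by positivity)

lemma bdry_bound {E : Type*} [NormedAddCommGroup E] [NormedSpace ℝ E] [ProperSpace E]
    (f g : E → ℝ) (hf : ContDiff ℝ 1 f) (hg : ContDiff ℝ 1 g) 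
    (hbd : Bornology.IsBounded {x | f x < 0})
    (hreg : ∀ x, f x = 0 → fderiv ℝ f x ≠ 0) (hg0 : ∀ x, f x = 0 → g x = 0) :
    ∃ C, 0 ≤ C ∧ ∀ x, f x < 0 → |g x| ≤ C * |f x| := by
  have hfd : Differentiable ℝ f := hf.differentiable (by norm_num)
  have hgd : Differentiable ℝ g := hg.differentiable (by norm_num)
  have hfc : Continuous (fderiv ℝ f) := hf.continuous_fderiv (by norm_num)
  have hgc : Continuous (fderiv ℝ g) := hg.continuous_fderiv (by norm_num)
  have hloc : ∀ x0, f x0 ≤ 0 → ∃ U ∈ nhds x0, ∃ C, 0 ≤ C ∧ ∀ x ∈ U, f x < 0 → |g x| ≤ C * |f x| := by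
    intro x0 hx0
    rcases hx0.eq_or_lt with h0 | hneg
    · obtain ⟨v, hv⟩ : ∃ v, 0 < fderiv ℝ f x0 v := by
        by_contra! hcon
        apply hreg x0 h0
        ext v
        have h1 := hcon v
        have h2 := hcon (-v)
        rw [map_neg] at h2
        simp; linarith
      set c := fderiv ℝ f x0 v / 2 with hc
      have hcpos : 0 < c := by positivity
      set L := ‖fderiv ℝ g x0‖ + 1 with hL
      have hLpos : 0 < L := by positivity
      have e1 : ∀ᶠ y in nhds x0, c < fderiv ℝ f y v := by
        have : Continuous (fun y => fderiv ℝ f y v) := by fun_prop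
        exact this.continuousAt.eventually_const_lt (by show c < fderiv ℝ f x0 v; linarith)
      have e2 : ∀ᶠ y in nhds x0, ‖fderiv ℝ g y‖ < L := by
        have : Continuous (fun y => ‖fderiv ℝ g y‖) := by fun_prop
        exact this.continuousAt.eventually_lt_const (by show ‖fderiv ℝ g x0‖ < L; linarith)
      obtain ⟨r, hr, hball⟩ := Metric.eventually_nhds_iff_ball.1 (e1.and e2)
      have e3 : ∀ᶠ x in nhds x0, |f x| / c * ‖v‖ < r / 2 := by
        have : Continuous (fun x => |f x| / c * ‖v‖) := by
          have := hfd.continuous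
          fun_prop
        exact this.continuousAt.eventually_lt_const (by simp [h0, hr])
      refine ⟨_, Filter.inter_mem e3 (Metric.ball_mem_nhds x0 (half_pos hr)), L * ‖v‖ / c, by positivity, ?_⟩
      rintro x ⟨hx3, hxb⟩ hfx
      simp only [Set.mem_ofPred_eq] at hx3
      set s0 := |f x| / c with hs0
      have hs0nn : 0 ≤ s0 := by positivity
      have hmem : ∀ s ∈ Set.Icc 0 s0, x + s • v ∈ Metric.ball x0 r := by
        intro s hs
        rw [Metric.mem_ball, dist_eq_norm] at hxb ⊢
        calc ‖x + s • v - x0‖ = ‖(x - x0) + s • v‖ := by congr 1; abel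
          _ ≤ ‖x - x0‖ + ‖s • v‖ := norm_add_le _ _
          _ = ‖x - x0‖ + s * ‖v‖ := by rw [norm_smul, Real.norm_eq_abs, abs_of_nonneg hs.1]
          _ ≤ ‖x - x0‖ + s0 * ‖v‖ := by gcongr; exact hs.2
          _ < r := by linarith
      have hder : ∀ s : ℝ, HasDerivAt (fun s : ℝ => f (x + s • v)) (fderiv ℝ f (x + s • v) v) s := by
        intro s
        have h1 : HasDerivAt (fun s : ℝ => x + s • v) v s := by
          simpa using ((hasDerivAt_id s).smul_const v).const_add x
        exact (hfd (x + s • v)).hasFDerivAt.comp_hasDerivAt s h1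
      have hcont : Continuous (fun s : ℝ => f (x + s • v)) := by
        have := hfd.continuous
        fun_prop
      have hmvt := Convex.mul_sub_le_image_sub_of_le_deriv (convex_Icc 0 s0) hcont.continuousOn
        (fun s _ => (hder s).differentiableAt.differentiableWithinAt) (C := c)
        (fun s hs => by
          rw [(hder s).deriv]
          exact (hball _ (hmem s (interior_subset hs))).1.le)
        0 (Set.left_mem_Icc.2 hs0nn) s0 (Set.right_mem_Icc.2 hs0nn) hs0nn
      have hcs : c * s0 = - f x := by
        rw [hs0, abs_of_neg hfx]; field_simp
      simp only [sub_zero, zero_smul, add_zero, hcs] at hmvt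
      have hivt := intermediate_value_Icc hs0nn hcont.continuousOn
      obtain ⟨s, hs, hfs⟩ := hivt (show (0:ℝ) ∈ _ from ⟨by simpa using hfx.le, by simpa using by linarith⟩)
      have hgs := hg0 _ hfs
      have hb := Convex.norm_image_sub_le_of_norm_fderiv_le (fun y _ => hgd y) 
        (fun y hy => (hball y hy).2.le) (convex_ball x0 r) (hmem s hs) 
        (by simpa using hmem 0 (Set.left_mem_Icc.2 hs0nn))
      rw [hgs, sub_zero, Real.norm_eq_abs, show x - (x + s • v) = -(s • v) by abel, norm_neg, norm_smul,
        Real.norm_eq_abs, abs_of_nonneg hs.1] at hb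
      calc |g x| ≤ L * (s * ‖v‖) := hb
        _ ≤ L * (s0 * ‖v‖) := by gcongr; exact hs.2
        _ = L * ‖v‖ / c * |f x| := by rw [hs0]; ring
    · have e1 : ∀ᶠ y in nhds x0, |f x0| / 2 < |f y| := by
        have : Continuous (fun y => |f y|) := hfd.continuous.abs
        have h2 := abs_pos.2 hneg.ne
        exact this.continuousAt.eventually_const_lt (by show |f x0| / 2 < |f x0|; linarith)
      have e2 : ∀ᶠ y in nhds x0, |g y| < |g x0| + 1 := by
        have : Continuous (fun y => |g y|) := hgd.continuous.abs
        exact this.continuousAt.eventually_lt_const (by show |g x0| < |g x0| + 1; linarith)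
      have h2 := abs_pos.2 hneg.ne
      refine ⟨_, e1.and e2, (|g x0| + 1) / (|f x0| / 2), by positivity, ?_⟩
      rintro x ⟨h3, h4⟩ -
      rw [div_mul_eq_mul_div, le_div_iff₀ (by positivity)]
      gcongr
  have hK : IsCompact (closure {x | f x < 0}) := hbd.isCompact_closure
  have hcl : ∀ x ∈ closure {x | f x < 0}, f x ≤ 0 := 
    fun x hx => closure_lt_subset_le hfd.continuous continuous_const hx
  have := hK.induction_on (p := fun S => ∃ C, 0 ≤ C ∧ ∀ x ∈ S, f x < 0 → |g x| ≤ C * |f x|)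
    ⟨0, le_rfl, by simp⟩ 
    (fun s t hst ⟨C, h0, h⟩ => ⟨C, h0, fun x hx => h x (hst hx)⟩)
    (fun s t ⟨C, h0, h⟩ ⟨C', h0', h'⟩ => ⟨max C C', le_max_of_le_left h0, fun x hx hf => by
      rcases hx with hx | hx
      · exact (h x hx hf).trans (by gcongr; exact le_max_left _ _)
      · exact (h' x hx hf).trans (by gcongr; exact le_max_right _ _)⟩)
    (fun x hx => by
      obtain ⟨U, hU, h⟩ := hloc x (hcl x hx)
      exact ⟨U, mem_nhdsWithin_of_mem_nhds hU, h⟩)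
  obtain ⟨C, h0, h⟩ := this
  exact ⟨C, h0, fun x hx => h x (subset_closure hx) hx⟩

lemma exists_cutoff : ∃ η : ℝ → ℝ, ContDiff ℝ 1 η ∧ (∀ s ≤ 1, η s = 0) ∧ (∀ s ≥ 2, η s = 1) ∧
    (∀ s, |η s| ≤ 1) ∧ (∀ s > 2, deriv η s = 0) ∧ ∃ K, ∀ s, |s * deriv η s| ≤ K := by
  have hc : ContDiff ℝ 1 (fun s : ℝ => Real.smoothTransition (s - 1)) :=
    (Real.smoothTransition.contDiff (n := 1)).comp (contDiff_id.sub contDiff_const)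
  have h2 : ∀ s > 2, deriv (fun s : ℝ => Real.smoothTransition (s - 1)) s = 0 := by
    intro s hs
    have : (fun s : ℝ => Real.smoothTransition (s - 1)) =ᶠ[nhds s] fun _ => 1 := by
      filter_upwards [lt_mem_nhds hs] with y hy
      exact Real.smoothTransition.one_of_one_le (by linarith)
    rw [this.deriv_eq]; simp
  have h1 : ∀ s < 1, deriv (fun s : ℝ => Real.smoothTransition (s - 1)) s = 0 := by
    intro s hs
    have : (fun s : ℝ => Real.smoothTransition (s - 1)) =ᶠ[nhds s] fun _ => 0 := by
      filter_upwards [gt_mem_nhds hs] with y hy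
      exact Real.smoothTransition.zero_of_nonpos (by linarith)
    rw [this.deriv_eq]; simp
  refine ⟨_, hc, fun s hs => Real.smoothTransition.zero_of_nonpos (by linarith),
    fun s hs => Real.smoothTransition.one_of_one_le (by linarith),
    fun s => ?_, h2, ?_⟩
  · rw [abs_of_nonneg (Real.smoothTransition.nonneg _)]
    exact Real.smoothTransition.le_one _
  · have hcont : Continuous (fun s : ℝ => s * deriv (fun s : ℝ => Real.smoothTransition (s - 1)) s) :=
      continuous_id.mul (hc.continuous_deriv le_rfl)
    obtain ⟨K, hK⟩ := (isCompact_Icc (a := (1:ℝ)) (b := 2)).exists_bound_of_continuousOn hcont.continuousOn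
    refine ⟨max K 0, fun s => ?_⟩
    by_cases hs : s ∈ Set.Icc (1:ℝ) 2
    · exact (hK s hs).trans (le_max_left _ _)
    · rw [Set.mem_Icc, not_and_or, not_le, not_le] at hs
      rcases hs with hs | hs
      · simp [h1 s hs]
      · simp [h2 s hs]

lemma integrableOn_of_cont {E : Type*} [NormedAddCommGroup E] [NormedSpace ℝ E] [ProperSpace E]
    [MeasurableSpace E] [BorelSpace E] {μ : Measure E} [IsFiniteMeasureOnCompacts μ]
    {Ω : Set E} (hbd : Bornology.IsBounded Ω) {h : E → ℝ} (hh : Continuous h) :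
    IntegrableOn h Ω μ :=
  (hh.continuousOn.integrableOn_compact hbd.isCompact_closure).mono_set subset_closure

lemma divergence_zero {E : Type*} [NormedAddCommGroup E] [NormedSpace ℝ E] [FiniteDimensional ℝ E]
    [MeasurableSpace E] [BorelSpace E] {μ : Measure E} [μ.IsAddHaarMeasure]
    {ι : Type*} [Fintype ι] (e : ι → E) (X : ι → E → ℝ) (hX : ∀ i, ContDiff ℝ 1 (X i))
    (f : E → ℝ) (hf : ContDiff ℝ 2 f)
    (hbd : Bornology.IsBounded {x | f x < 0})
    (hreg : ∀ x, f x = 0 → fderiv ℝ f x ≠ 0)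
    (hX0 : ∀ x, f x = 0 → ∑ i, X i x * fderiv ℝ f x (e i) = 0) :
    ∫ x in {x | f x < 0}, ∑ i, fderiv ℝ (X i) x (e i) ∂μ = 0 := by
  have : ProperSpace E := FiniteDimensional.proper ℝ E
  obtain ⟨η, hη, hη0, hη1, hηb, hηd, K, hK⟩ := exists_cutoff
  have hfC : Continuous f := hf.continuous
  have hfd : Differentiable ℝ f := hf.differentiable (by norm_num)
  have hfc : Continuous (fderiv ℝ f) := hf.continuous_fderiv (by norm_num)
  have hXc : ∀ i, Continuous (X i) := fun i => (hX i).continuous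
  have hXfc : ∀ i, Continuous (fderiv ℝ (X i)) := fun i => (hX i).continuous_fderiv (by norm_num)
  have hηc : Continuous η := hη.continuous
  have hηd' : Differentiable ℝ η := hη.differentiable (by norm_num)
  have hηdc : Continuous (deriv η) := hη.continuous_deriv le_rfl
  set Ω := {x | f x < 0} with hΩ
  have hΩm : MeasurableSet Ω := (isOpen_lt hfC continuous_const).measurableSet
  have : IsFiniteMeasure (μ.restrict Ω) := ⟨by simpa using hbd.measure_lt_top⟩
  set g : E → ℝ := fun x => ∑ i, X i x * fderiv ℝ f x (e i) with hg
  have hgC1 : ContDiff ℝ 1 g := by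
    apply ContDiff.sum
    intro i _
    exact (hX i).mul ((hf.fderiv_right (m := 1) (by norm_num)).clm_apply contDiff_const)
  have hgc : Continuous g := hgC1.continuous
  obtain ⟨C, hC0, hC⟩ := bdry_bound f g (hf.of_le (by norm_num)) hgC1 hbd hreg hX0
  set χ : ℕ → E → ℝ := fun k x => η (-((k:ℝ) + 1) * f x) with hχ
  have hχc : ∀ k, Continuous (χ k) := fun k => by simp only [hχ]; fun_prop
  have hχd : ∀ k x, HasFDerivAt (χ k)
      (deriv η (-((k:ℝ) + 1) * f x) • ((-((k:ℝ) + 1)) • fderiv ℝ f x)) x := fun k x =>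
    (hηd' _).hasDerivAt.comp_hasFDerivAt x ((hfd x).hasFDerivAt.const_mul _)
  have hχfd : ∀ k x, fderiv ℝ (χ k) x =
      (deriv η (-((k:ℝ) + 1) * f x) • ((-((k:ℝ) + 1)) • fderiv ℝ f x)) := fun k x => (hχd k x).fderiv
  have hχfc : ∀ k, Continuous (fderiv ℝ (χ k)) := by
    intro k
    rw [funext (hχfd k)]
    fun_prop
  have hχout : ∀ k x, x ∉ Ω → χ k x = 0 := by
    intro k x hx
    have : 0 ≤ f x := not_lt.1 hx
    apply hη0
    have : 0 ≤ ((k:ℝ) + 1) * f x := by positivity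
    linarith
  have hχsupp : ∀ k, HasCompactSupport (χ k) := fun k =>
    HasCompactSupport.intro hbd.isCompact_closure
      (fun x hx => hχout k x (fun h => hx (subset_closure h)))
  -- integration by parts
  have hibp : ∀ k i, ∫ x, χ k x * fderiv ℝ (X i) x (e i) ∂μ = - ∫ x, fderiv ℝ (χ k) x (e i) * X i x ∂μ := by
    intro k i
    apply integral_mul_fderiv_eq_neg_fderiv_mul_of_integrable
    · apply Continuous.integrable_of_hasCompactSupport
      · have := hχfc k; have := hXc i; fun_prop
      · exact ((hχsupp k).fderiv_apply ℝ (e i)).mul_right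
    · apply Continuous.integrable_of_hasCompactSupport
      · have := hχc k; have := hXfc i; fun_prop
      · exact (hχsupp k).mul_right
    · apply Continuous.integrable_of_hasCompactSupport
      · have := hχc k; have := hXc i; fun_prop
      · exact (hχsupp k).mul_right
    · exact fun x _ => (hχd k x).differentiableAt
    · exact fun x _ => (hX i).differentiable (by norm_num) x
  have hfdout : ∀ k x, x ∉ Ω → fderiv ℝ (χ k) x = 0 := by
    intro k x hx
    have h0 : 0 ≤ f x := not_lt.1 hx
    have : χ k =ᶠ[nhds x] fun _ => 0 := by
      have h1 : ∀ᶠ y in nhds x, -((k:ℝ) + 1) * f y < 1 := by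
        have : Continuous (fun y => -((k:ℝ) + 1) * f y) := by fun_prop
        refine this.continuousAt.eventually_lt_const ?_
        have : 0 ≤ ((k:ℝ) + 1) * f x := by positivity
        linarith
      filter_upwards [h1] with y hy using hη0 _ hy.le
    rw [this.fderiv_eq]; simp
  have hkey : ∀ k, ∫ x in Ω, χ k x * ∑ i, fderiv ℝ (X i) x (e i) ∂μ =
      ∫ x in Ω, ((k:ℝ) + 1) * deriv η (-((k:ℝ) + 1) * f x) * g x ∂μ := by
    intro k
    have h1 : ∀ i, ∫ x in Ω, χ k x * fderiv ℝ (X i) x (e i) ∂μ =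
        - ∫ x in Ω, fderiv ℝ (χ k) x (e i) * X i x ∂μ := by
      intro i
      rw [setIntegral_eq_integral_of_forall_compl_eq_zero, 
        setIntegral_eq_integral_of_forall_compl_eq_zero, hibp]
      · intro x hx; simp [hfdout k x hx]
      · intro x hx; simp [hχout k x hx]
    simp_rw [Finset.mul_sum]
    rw [integral_finsetSum]
    · simp_rw [h1]
      rw [Finset.sum_neg_distrib, ← integral_finsetSum, ← integral_neg]
      · congr 1
        ext x
        rw [hg]
        simp only [Finset.mul_sum, ← Finset.sum_neg_distrib]
        refine Finset.sum_congr rfl fun i _ => ?_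
        rw [hχfd]
        simp
        ring
      · intro i _
        apply integrableOn_of_cont hbd
        have := hχfc k; have := hXc i; fun_prop
    · intro i _
      apply integrableOn_of_cont hbd
      have := hχc k; have := hXfc i; fun_prop
  have hdiv : Continuous (fun x => ∑ i, fderiv ℝ (X i) x (e i)) := by fun_prop
  have hlarge : ∀ x ∈ Ω, ∀ᶠ k : ℕ in Filter.atTop, 2 < -((k:ℝ) + 1) * f x := by
    intro x hx
    have hx' : 0 < - f x := by have : f x < 0 := hx; linarith
    obtain ⟨N, hN⟩ := exists_nat_gt (2 / (- f x))
    filter_upwards [Filter.eventually_ge_atTop N] with k hk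
    have : (N:ℝ) ≤ k := by exact_mod_cast hk
    rw [div_lt_iff₀ hx'] at hN
    nlinarith
  have hL : Filter.Tendsto (fun k => ∫ x in Ω, χ k x * ∑ i, fderiv ℝ (X i) x (e i) ∂μ) Filter.atTop
      (nhds (∫ x in Ω, ∑ i, fderiv ℝ (X i) x (e i) ∂μ)) := by
    apply tendsto_integral_of_dominated_convergence (fun x => |∑ i, fderiv ℝ (X i) x (e i)|)
    · intro k
      exact ((hχc k).mul hdiv).aestronglyMeasurable
    · exact integrableOn_of_cont hbd hdiv.abs
    · intro k
      refine Filter.Eventually.of_forall fun x => ?_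
      rw [Real.norm_eq_abs, abs_mul]
      exact mul_le_of_le_one_left (abs_nonneg _) (hηb _)
    · filter_upwards [ae_restrict_mem hΩm] with x hx
      apply tendsto_const_nhds.congr'
      filter_upwards [hlarge x hx] with k hk
      rw [hχ]; simp only
      rw [hη1 _ hk.le, one_mul]
  have hR : Filter.Tendsto (fun k : ℕ => ∫ x in Ω, ((k:ℝ) + 1) * deriv η (-((k:ℝ) + 1) * f x) * g x ∂μ) Filter.atTop
      (nhds (∫ x in Ω, (0:ℝ) ∂μ)) := by
    apply tendsto_integral_of_dominated_convergence (fun x => K * C)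
    · intro k
      exact Continuous.aestronglyMeasurable (by fun_prop)
    · exact integrable_const _
    · intro k
      filter_upwards [ae_restrict_mem hΩm] with x hx
      have h1 := hK (-((k:ℝ) + 1) * f x)
      have h2 := hC x hx
      rw [Real.norm_eq_abs, abs_mul]
      calc |((k:ℝ) + 1) * deriv η (-((k:ℝ) + 1) * f x)| * |g x| 
          ≤ |((k:ℝ) + 1) * deriv η (-((k:ℝ) + 1) * f x)| * (C * |f x|) := by gcongr
        _ = |-((k:ℝ) + 1) * f x * deriv η (-((k:ℝ) + 1) * f x)| * C := by
          simp only [abs_mul, abs_neg]; ring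
        _ ≤ K * C := by gcongr
    · filter_upwards [ae_restrict_mem hΩm] with x hx
      apply tendsto_const_nhds.congr'
      filter_upwards [hlarge x hx] with k hk
      rw [hηd _ hk]; simp
  simp_rw [hkey] at hL
  rw [tendsto_nhds_unique hL hR]
  simp

lemma hasDerivAt_param {E : Type*} [NormedAddCommGroup E] [NormedSpace ℝ E] [ProperSpace E]
    [SecondCountableTopology E]
    [MeasurableSpace E] [BorelSpace E] {μ : Measure E} [IsFiniteMeasureOnCompacts μ]
    {Ω : Set E} (hbd : Bornology.IsBounded Ω) (hΩm : MeasurableSet Ω) (F F' : ℝ × E → ℝ) 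
    (hF : Continuous F) (hF' : Continuous F')
    (hd : ∀ t x, HasDerivAt (fun τ => F (τ, x)) (F' (t, x)) t) (t : ℝ) :
    HasDerivAt (fun τ => ∫ x in Ω, F (τ, x) ∂μ) (∫ x in Ω, F' (t, x) ∂μ) t := by
  have : IsFiniteMeasure (μ.restrict Ω) := ⟨by simpa using hbd.measure_lt_top⟩
  obtain ⟨K, hK⟩ := ((isCompact_Icc (a := t - 1) (b := t + 1)).prod 
    hbd.isCompact_closure).exists_bound_of_continuousOn hF'.continuousOn
  refine (hasDerivAt_integral_of_dominated_loc_of_deriv_le (bound := fun _ => K)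
    (F := fun τ x => F (τ, x)) (F' := fun τ x => F' (τ, x))
    (Icc_mem_nhds (show t - 1 < t by linarith) (show t < t + 1 by linarith)) ?_ ?_ ?_ ?_ ?_ ?_).2
  · exact Filter.Eventually.of_forall fun τ => Continuous.aestronglyMeasurable (by fun_prop)
  · exact integrableOn_of_cont hbd (by fun_prop)
  · exact Continuous.aestronglyMeasurable (by fun_prop)
  · filter_upwards [ae_restrict_mem hΩm] with x hx τ hτ
    exact hK (τ, x) ⟨hτ, subset_closure hx⟩
  · exact integrable_const _
  · exact Filter.Eventually.of_forall fun x τ _ => hd τ x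

lemma inner_gradient_eq {n : ℕ} (a b : EuclideanSpace ℝ (Fin n) → ℝ) (x : EuclideanSpace ℝ (Fin n)) :
    ⟪gradient a x, gradient b x⟫ = ∑ i, fderiv ℝ a x (EuclideanSpace.single i 1) *
      fderiv ℝ b x (EuclideanSpace.single i 1) := by
  have h : ∀ (c : EuclideanSpace ℝ (Fin n) → ℝ) i, gradient c x i = fderiv ℝ c x (EuclideanSpace.single i 1) := by
    intro c i
    rw [← inner_gradient_left, EuclideanSpace.inner_single_right]
    simp
  rw [PiLp.inner_apply]
  refine Finset.sum_congr rfl fun i _ => ?_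
  rw [h, h]
  simp [mul_comm]

lemma norm_gradient_sq {n : ℕ} (a : EuclideanSpace ℝ (Fin n) → ℝ) (x : EuclideanSpace ℝ (Fin n)) :
    ‖gradient a x‖ ^ 2 = ∑ i, fderiv ℝ a x (EuclideanSpace.single i 1) ^ 2 := by
  rw [← real_inner_self_eq_norm_sq, inner_gradient_eq]
  simp [sq]

/- STATEMENT 15 (semidecreasing property): for a smooth solution u^ε of the Allen–Cahn equation
ε∂ₜu = εΔu − W'(u)/ε on Ω × (0,∞) with Neumann boundary condition (Ω a bounded smooth domain
encoded as a regular sublevel set of f) and energy bounded by c₁, for every nonnegative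
φ ∈ C² with ‖φ‖_{C²} ≤ M, the function t ↦ ∫_Ω φ dμ_t^ε − c₁ M t is nonincreasing on [0,∞),
where dμ_t^ε = (ε|∇u^ε|²/2 + W(u^ε)/ε) dx. -/
theorem energy_semidecreasing
    (n : ℕ) (hn : 2 ≤ n) (Ω : Set (EuclideanSpace ℝ (Fin n)))
    (hΩbd : Bornology.IsBounded Ω)
    (f : EuclideanSpace ℝ (Fin n) → ℝ) (hf : ContDiff ℝ (⊤ : ℕ∞) f)
    (hΩ : Ω = {x | f x < 0})
    (hfr : frontier Ω = {x | f x = 0})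
    (hreg : ∀ x ∈ frontier Ω, gradient f x ≠ 0)
    (W : ℝ → ℝ) (hW : ContDiff ℝ 1 W) (hWpos : ∀ v, 0 ≤ W v)
    (ε : ℝ) (hε : 0 < ε)
    (u : ℝ → EuclideanSpace ℝ (Fin n) → ℝ)
    (hu : ContDiff ℝ (⊤ : ℕ∞) (fun p : ℝ × EuclideanSpace ℝ (Fin n) => u p.1 p.2))
    (heq : ∀ t > (0 : ℝ), ∀ x ∈ Ω,
      ε * deriv (fun τ => u τ x) t =
        ε * (∑ i : Fin n,
          fderiv ℝ (fun z => fderiv ℝ (u t) z (EuclideanSpace.single i 1)) x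
            (EuclideanSpace.single i 1)) - deriv W (u t x) / ε)
    (hNeu : ∀ t > (0 : ℝ), ∀ x ∈ frontier Ω, ⟪gradient (u t) x, gradient f x⟫ = 0)
    (c₁ : ℝ)
    (hE : ∀ t > (0 : ℝ),
      (∫ x in Ω, (ε * ‖gradient (u t) x‖ ^ 2 / 2 + W (u t x) / ε)) ≤ c₁)
    (φ : EuclideanSpace ℝ (Fin n) → ℝ) (hφ : ContDiff ℝ 2 φ) (hφ0 : ∀ x, 0 ≤ φ x)
    (M : ℝ)
    (hM : ∀ x, |φ x| ≤ M ∧ ‖gradient φ x‖ ≤ M ∧ ‖iteratedFDeriv ℝ 2 φ x‖ ≤ M) :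
    AntitoneOn
      (fun t =>
        (∫ x in Ω, φ x * (ε * ‖gradient (u t) x‖ ^ 2 / 2 + W (u t x) / ε)) - c₁ * M * t)
      (Set.Ici 0) := by
  classical
  subst hΩ
  have hM0 : 0 ≤ M := (abs_nonneg _).trans (hM 0).1
  set e : Fin n → EuclideanSpace ℝ (Fin n) := fun i => EuclideanSpace.single i 1 with he
  set U : ℝ × EuclideanSpace ℝ (Fin n) → ℝ := fun p => u p.1 p.2 with hU
  have hUd : Differentiable ℝ U := hu.differentiable (by simp)
  have hu3 : ContDiff ℝ 3 U := contDiff_infty.1 hu 3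
  have hf2 : ContDiff ℝ 2 f := contDiff_infty.1 hf 2
  have hU' : ContDiff ℝ 2 (fderiv ℝ U) := hu3.fderiv_right (by norm_num)
  have hU'd : Differentiable ℝ (fderiv ℝ U) := hU'.differentiable (by norm_num)
  set V : ℝ × EuclideanSpace ℝ (Fin n) → ℝ := fun p => fderiv ℝ U p (1, 0) with hV
  set D : Fin n → ℝ × EuclideanSpace ℝ (Fin n) → ℝ := fun i p => fderiv ℝ U p (0, e i) with hD
  have hVC : ContDiff ℝ 2 V := hU'.clm_apply contDiff_const
  have hDC : ∀ i, ContDiff ℝ 2 (D i) := fun i => hU'.clm_apply contDiff_const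
  have hVc : Continuous V := hVC.continuous
  have hDc : ∀ i, Continuous (D i) := fun i => (hDC i).continuous
  have hVfc : Continuous (fderiv ℝ V) := hVC.continuous_fderiv (by norm_num)
  have hDfc : ∀ i, Continuous (fderiv ℝ (D i)) := fun i => (hDC i).continuous_fderiv (by norm_num)
  have hUc : Continuous U := hUd.continuous
  have hφc : Continuous φ := hφ.continuous
  have hφd : Differentiable ℝ φ := hφ.differentiable (by norm_num)
  have hφfc : Continuous (fderiv ℝ φ) := hφ.continuous_fderiv (by norm_num)
  have hWc : Continuous W := hW.continuous
  have hWd : Differentiable ℝ W := hW.differentiable (by norm_num)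
  have hWdc : Continuous (deriv W) := hW.continuous_deriv le_rfl
  have hinc : ∀ (t : ℝ) (x : EuclideanSpace ℝ (Fin n)),
      HasFDerivAt (fun z : EuclideanSpace ℝ (Fin n) => (t, z)) 
        (ContinuousLinearMap.inr ℝ ℝ (EuclideanSpace ℝ (Fin n))) x := fun t x =>
    hasFDerivAt_prodMk_right t x
  have hinct : ∀ (t : ℝ) (x : EuclideanSpace ℝ (Fin n)),
      HasDerivAt (fun τ : ℝ => (τ, x)) ((1 : ℝ), (0 : EuclideanSpace ℝ (Fin n))) t := fun t x =>
    (hasDerivAt_id t).prodMk (hasDerivAt_const t x)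
  -- spatial and time derivatives of functions on the product
  have hspace : ∀ (G : ℝ × EuclideanSpace ℝ (Fin n) → ℝ), Differentiable ℝ G → ∀ t x v,
      fderiv ℝ (fun z => G (t, z)) x v = fderiv ℝ G (t, x) (0, v) := by
    intro G hG t x v
    have h := (hG (t, x)).hasFDerivAt.comp x (hinc t x)
    have h2 : fderiv ℝ (fun z => G (t, z)) x = _ := h.fderiv
    rw [h2]; simp
  have htime : ∀ (G : ℝ × EuclideanSpace ℝ (Fin n) → ℝ), Differentiable ℝ G → ∀ t x,
      HasDerivAt (fun τ => G (τ, x)) (fderiv ℝ G (t, x) (1, 0)) t := by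
    intro G hG t x
    exact (hG (t, x)).hasFDerivAt.comp_hasDerivAt t (hinct t x)
  have hDu : ∀ t x i, fderiv ℝ (u t) x (e i) = D i (t, x) := fun t x i => hspace U hUd t x (e i)
  have hVu : ∀ t x, deriv (fun τ => u τ x) t = V (t, x) := fun t x => (htime U hUd t x).deriv
  have hsymm : ∀ i p, fderiv ℝ (D i) p (1, 0) = fderiv ℝ V p (0, e i) := by
    intro i p
    have h1 : ∀ a b, fderiv ℝ (fun q => fderiv ℝ U q a) p b = fderiv ℝ (fderiv ℝ U) p b a := by
      intro a b
      rw [fderiv_clm_apply (hU'd p) (differentiableAt_const _)]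
      simp
    rw [hD, hV, h1, h1]
    have hs : IsSymmSndFDerivAt ℝ U p := (hu3.of_le (by norm_num : (2 : WithTop ℕ∞) ≤ 3)).contDiffAt.isSymmSndFDerivAt (by simp)
    exact hs _ _
  have hgrad : ∀ t x, ‖gradient (u t) x‖ ^ 2 = ∑ i, D i (t, x) ^ 2 := by
    intro t x
    rw [norm_gradient_sq]
    exact Finset.sum_congr rfl fun i _ => by rw [← hDu]
  have hΩm : MeasurableSet {x | f x < 0} := (isOpen_lt hf.continuous continuous_const).measurableSet
  -- the time derivative of the localized energy
  set F : ℝ × EuclideanSpace ℝ (Fin n) → ℝ := fun p =>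
    φ p.2 * (ε * (∑ i, D i p ^ 2) / 2 + W (U p) / ε) with hF
  set F' : ℝ × EuclideanSpace ℝ (Fin n) → ℝ := fun p =>
    φ p.2 * (ε * (∑ i, D i p * fderiv ℝ V p (0, e i)) + deriv W (U p) * V p / ε) with hF'
  have hFder : ∀ t x, HasDerivAt (fun τ => F (τ, x)) (F' (t, x)) t := by
    intro t x
    have h1 : ∀ i, HasDerivAt (fun τ => D i (τ, x)) (fderiv ℝ V (t, x) (0, e i)) t := by
      intro i
      rw [← hsymm]
      exact htime (D i) ((hDC i).differentiable (by norm_num)) t x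
    have h2 : HasDerivAt (fun τ => ∑ i, D i (τ, x) ^ 2)
        (∑ i, 2 * D i (t, x) * fderiv ℝ V (t, x) (0, e i)) t := by
      apply HasDerivAt.fun_sum
      intro i _
      simpa using (h1 i).fun_pow 2
    have h3 : HasDerivAt (fun τ => W (U (τ, x))) (deriv W (U (t, x)) * V (t, x)) t :=
      (hWd _).hasDerivAt.comp t (htime U hUd t x)
    have h4 := ((((h2.const_mul ε).div_const 2).add (h3.div_const ε)).const_mul (φ x))
    refine h4.congr_deriv ?_
    simp only [hF']
    congr 2
    rw [mul_div_assoc, Finset.sum_div]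
    congr 1
    exact Finset.sum_congr rfl fun i _ => by ring
  have hFc : Continuous F := by fun_prop
  have hF'c : Continuous F' := by fun_prop
  have hFint : ∀ t, HasDerivAt (fun τ => ∫ x in {x | f x < 0}, F (τ, x))
      (∫ x in {x | f x < 0}, F' (t, x)) t :=
    fun t => hasDerivAt_param hΩbd hΩm F F' hFc hF'c hFder t
  have hrew : (fun t => (∫ x in {x | f x < 0}, φ x * (ε * ‖gradient (u t) x‖ ^ 2 / 2 + W (u t x) / ε))
      - c₁ * M * t) = fun t => (∫ x in {x | f x < 0}, F (t, x)) - c₁ * M * t := by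
    funext t
    simp only [hgrad, hF, hU]
  rw [hrew]
  have hder : ∀ t, HasDerivAt (fun t => (∫ x in {x | f x < 0}, F (t, x)) - c₁ * M * t)
      ((∫ x in {x | f x < 0}, F' (t, x)) - c₁ * M) t := by
    intro t
    have := (hFint t).fun_sub ((hasDerivAt_id t).const_mul (c₁ * M))
    rw [mul_one] at this
    exact this
  apply antitoneOn_of_deriv_nonpos (convex_Ici 0)
  · exact fun t _ => (hder t).continuousAt.continuousWithinAt
  · exact fun t _ => (hder t).differentiableAt.differentiableWithinAt
  intro t ht
  rw [interior_Ici] at ht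
  have ht0 : 0 < t := ht
  rw [(hder t).deriv, sub_nonpos]
  -- divergence theorem
  set X : Fin n → EuclideanSpace ℝ (Fin n) → ℝ := fun i x => φ x * V (t, x) * D i (t, x) with hX
  have hVt : ContDiff ℝ 1 (fun x => V (t, x)) :=
    (hVC.of_le (by norm_num)).comp (contDiff_const.prodMk contDiff_id)
  have hDt : ∀ i, ContDiff ℝ 1 (fun x => D i (t, x)) := fun i =>
    ((hDC i).of_le (by norm_num)).comp (contDiff_const.prodMk contDiff_id)
  have hφ1 : ContDiff ℝ 1 φ := hφ.of_le (by norm_num)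
  have hXC : ∀ i, ContDiff ℝ 1 (X i) := fun i => (hφ1.mul hVt).mul (hDt i)
  have hdiv := divergence_zero (μ := volume) e X hXC f hf2 hΩbd
    (by
      intro x hx h0
      apply hreg x (by rw [hfr]; exact hx)
      rw [gradient, h0, map_zero])
    (by
      intro x hx
      have h := hNeu t ht0 x (by rw [hfr]; exact hx)
      rw [inner_gradient_eq] at h
      calc ∑ i, X i x * fderiv ℝ f x (e i) 
          = φ x * V (t, x) * ∑ i, fderiv ℝ (u t) x (e i) * fderiv ℝ f x (e i) := by
            rw [Finset.mul_sum]
            exact Finset.sum_congr rfl fun i _ => by rw [hDu]; ring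
        _ = 0 := by rw [h, mul_zero])
  have hXder : ∀ x i, fderiv ℝ (X i) x (e i) = fderiv ℝ φ x (e i) * V (t, x) * D i (t, x)
      + φ x * fderiv ℝ V (t, x) (0, e i) * D i (t, x) + φ x * V (t, x) * fderiv ℝ (D i) (t, x) (0, e i) := by
    intro x i
    have h1 := (hφd x).hasFDerivAt
    have h2 := (hVt.differentiable (by norm_num) x).hasFDerivAt
    have h3 := ((hDt i).differentiable (by norm_num) x).hasFDerivAt
    have h4 := ((h1.mul h2).mul h3).fderiv
    have h5 : fderiv ℝ (X i) x = _ := h4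
    rw [h5]
    simp [hspace V (hVC.differentiable (by norm_num)), hspace (D i) ((hDC i).differentiable (by norm_num))]
    ring
  have hdivc : Continuous (fun x => ∑ i, fderiv ℝ (X i) x (e i)) := by
    have := fun i => (hXC i).continuous_fderiv (by norm_num)
    fun_prop
  have hF'tc : Continuous (fun x => F' (t, x)) := by fun_prop
  have hdensc : Continuous (fun x => ε * ‖gradient (u t) x‖ ^ 2 / 2 + W (u t x) / ε) := by
    have : (fun x => ε * ‖gradient (u t) x‖ ^ 2 / 2 + W (u t x) / ε) =
      fun x => ε * (∑ i, D i (t, x) ^ 2) / 2 + W (U (t, x)) / ε := by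
      funext x; rw [hgrad]
    rw [this]
    fun_prop
  have hpt : ∀ x ∈ {x | f x < 0}, F' (t, x) - ε * ∑ i, fderiv ℝ (X i) x (e i) ≤
      M * (ε * ‖gradient (u t) x‖ ^ 2 / 2 + W (u t x) / ε) := by
    intro x hx
    have hpde := heq t ht0 x hx
    have hlap : ∑ i : Fin n, fderiv ℝ (fun z => fderiv ℝ (u t) z (EuclideanSpace.single i 1)) x
        (EuclideanSpace.single i 1) = ∑ i, fderiv ℝ (D i) (t, x) (0, e i) := by
      refine Finset.sum_congr rfl fun i _ => ?_
      have : (fun z => fderiv ℝ (u t) z (EuclideanSpace.single i 1)) = fun z => D i (t, z) := 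
        funext fun z => hDu t z i
      rw [this]
      exact hspace (D i) ((hDC i).differentiable (by norm_num)) t x (e i)
    rw [hlap, hVu] at hpde
    have hin : ⟪gradient φ x, gradient (u t) x⟫ = ∑ i, fderiv ℝ φ x (e i) * D i (t, x) := by
      rw [inner_gradient_eq]
      exact Finset.sum_congr rfl fun i _ => by rw [← hDu]
    have hsum : ∑ i, fderiv ℝ (X i) x (e i) = V (t, x) * ⟪gradient φ x, gradient (u t) x⟫ 
        + φ x * (∑ i, D i (t, x) * fderiv ℝ V (t, x) (0, e i))
        + φ x * V (t, x) * ∑ i, fderiv ℝ (D i) (t, x) (0, e i) := by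
      rw [hin]
      simp only [Finset.mul_sum, ← Finset.sum_add_distrib]
      refine Finset.sum_congr rfl fun i _ => ?_
      rw [hXder]; ring
    have hineq := pointwise_ineq ε (V (t, x)) ⟪gradient φ x, gradient (u t) x⟫ (φ x) M
      (‖gradient (u t) x‖ ^ 2) hε (hφ0 x) (by
        have h1 := abs_real_inner_le_norm (gradient φ x) (gradient (u t) x)
        have h2 := grad_sq_le φ hφ hφ0 M hM x
        calc ⟪gradient φ x, gradient (u t) x⟫ ^ 2 = |⟪gradient φ x, gradient (u t) x⟫| ^ 2 := (sq_abs _).symm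
          _ ≤ (‖gradient φ x‖ * ‖gradient (u t) x‖) ^ 2 := by gcongr
          _ = ‖gradient φ x‖ ^ 2 * ‖gradient (u t) x‖ ^ 2 := by ring
          _ ≤ 2 * M * φ x * ‖gradient (u t) x‖ ^ 2 := by gcongr) hM0 (sq_nonneg _)
    have hWn : 0 ≤ M * (W (u t x) / ε) := mul_nonneg hM0 (div_nonneg (hWpos _) hε.le)
    have hWt : deriv W (U (t, x)) / ε = ε * ∑ i, fderiv ℝ (D i) (t, x) (0, e i) - ε * V (t, x) := by
      have : U (t, x) = u t x := rfl
      rw [this]; linarith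
    have hcalc : F' (t, x) - ε * ∑ i, fderiv ℝ (X i) x (e i) = 
        - ε * V (t, x) * ⟪gradient φ x, gradient (u t) x⟫ - ε * φ x * V (t, x) ^ 2 := by
      rw [hsum]
      simp only [hF']
      rw [mul_div_right_comm, hWt]
      ring
    rw [hcalc, mul_add]
    linarith
  have hint := setIntegral_mono_on (μ := volume)
    (integrableOn_of_cont hΩbd (hF'tc.fun_sub (hdivc.const_mul ε)))
    (integrableOn_of_cont hΩbd (hdensc.const_mul M)) hΩm hpt
  rw [integral_sub (integrableOn_of_cont hΩbd hF'tc) 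
    (integrableOn_of_cont hΩbd (hdivc.const_mul ε)), integral_const_mul, integral_const_mul, hdiv,
    mul_zero, sub_zero] at hint
  calc _ ≤ _ := hint
    _ ≤ M * c₁ := by gcongr; exact hE t ht0
    _ = c₁ * M := mul_comm _ _
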